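/- arXiv:quant-ph/0402154 — 3 statements merged into one kernel-verified Lean document; each statement's English description precedes it below -/
import Mathlib

section
/- The explicit matrix V₊(u) := (2ε(u)(ε(u)+mc²))^(−1/2)·[ (ε(u)+mc²)·I₂ ; u·σ ] (a 4×2 complex matrix written in two 2×2 blocks, upper block (ε(u)+mc²)·I₂ and lower block u·σ) is an isometry onto the particle eigenspace: V₊(u)ᴴ·V₊(u) = I₂, V₊(u)·V₊(u)ᴴ = Π₊(u), and H(u,a)·V₊(u) = h₊(u,a)·V₊(u) for every u ∈ ℝ³ and a ∈ ℝ. -/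
open Matrix Complex

noncomputable section

/-- The Pauli matrices `σ₁, σ₂, σ₃` as `2 × 2` complex matrices. -/
def pauli : Fin 3 → Matrix (Fin 2) (Fin 2) ℂ
  | 0 => !![0, 1; 1, 0]
  | 1 => !![0, -Complex.I; Complex.I, 0]
  | 2 => !![1, 0; 0, -1]

/-- The Dirac matrices `α_k = fromBlocks 0 σ_k σ_k 0`. -/
def diracAlpha (k : Fin 3) : Matrix (Fin 2 ⊕ Fin 2) (Fin 2 ⊕ Fin 2) ℂ :=
  Matrix.fromBlocks 0 (pauli k) (pauli k) 0

/-- The Dirac matrix `β = fromBlocks I₂ 0 0 (-I₂)`. -/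
def diracBeta : Matrix (Fin 2 ⊕ Fin 2) (Fin 2 ⊕ Fin 2) ℂ :=
  Matrix.fromBlocks 1 0 0 (-1)

/-- `ε(u) = √(‖u‖² + m²c⁴)`. -/
def diracEps (m c : ℝ) (u : EuclideanSpace ℝ (Fin 3)) : ℝ :=
  Real.sqrt (‖u‖ ^ 2 + m ^ 2 * c ^ 4)

/-- The Dirac symbol matrix `H(u,a) = u·α + mc²β + a·I₄`. -/
def diracSymbol (m c : ℝ) (u : EuclideanSpace ℝ (Fin 3)) (a : ℝ) :
    Matrix (Fin 2 ⊕ Fin 2) (Fin 2 ⊕ Fin 2) ℂ :=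
  (u 0 : ℂ) • diracAlpha 0 + (u 1 : ℂ) • diracAlpha 1 + (u 2 : ℂ) • diracAlpha 2 +
    ((m * c ^ 2 : ℝ) : ℂ) • diracBeta + ((a : ℝ) : ℂ) • (1 : Matrix (Fin 2 ⊕ Fin 2) (Fin 2 ⊕ Fin 2) ℂ)

/-- The eigenprojection symbols `Π±(u) = ½(I₄ ± ε(u)⁻¹(u·α + mc²β))`. -/
def diracProj (m c : ℝ) (s : Bool) (u : EuclideanSpace ℝ (Fin 3)) :
    Matrix (Fin 2 ⊕ Fin 2) (Fin 2 ⊕ Fin 2) ℂ :=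
  (1 / 2 : ℂ) • ((1 : Matrix (Fin 2 ⊕ Fin 2) (Fin 2 ⊕ Fin 2) ℂ) +
    (if s then 1 else -1 : ℂ) • (((diracEps m c u)⁻¹ : ℝ) : ℂ) •
      ((u 0 : ℂ) • diracAlpha 0 + (u 1 : ℂ) • diracAlpha 1 + (u 2 : ℂ) • diracAlpha 2 +
        ((m * c ^ 2 : ℝ) : ℂ) • diracBeta))


/-- `v·σ = v₁σ₁ + v₂σ₂ + v₃σ₃`. -/
def pauliVec (v : EuclideanSpace ℝ (Fin 3)) : Matrix (Fin 2) (Fin 2) ℂ :=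
  (v 0 : ℂ) • pauli 0 + (v 1 : ℂ) • pauli 1 + (v 2 : ℂ) • pauli 2

/-- The isometry `V₊(u)` onto the particle eigenspace, a `4 × 2` matrix with
upper block `(ε(u)+mc²)·I₂` and lower block `u·σ`, normalised by
`(2ε(u)(ε(u)+mc²))^(-1/2)`. -/
def diracVplus (m c : ℝ) (u : EuclideanSpace ℝ (Fin 3)) :
    Matrix (Fin 2 ⊕ Fin 2) (Fin 2) ℂ :=
  (((Real.sqrt (2 * diracEps m c u * (diracEps m c u + m * c ^ 2)))⁻¹ : ℝ) : ℂ) •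
    Matrix.fromRows (((diracEps m c u + m * c ^ 2 : ℝ) : ℂ) • (1 : Matrix (Fin 2) (Fin 2) ℂ))
      (pauliVec u)

theorem conjTranspose_pauliVec (v : EuclideanSpace ℝ (Fin 3)) :
    (pauliVec v)ᴴ = pauliVec v := by
  ext i j
  fin_cases i <;> fin_cases j <;> simp [pauliVec, pauli]

theorem pauliVec_mul_self (v : EuclideanSpace ℝ (Fin 3)) :
    pauliVec v * pauliVec v = ((‖v‖ ^ 2 : ℝ) : ℂ) • (1 : Matrix (Fin 2) (Fin 2) ℂ) := by
  rw [EuclideanSpace.real_norm_sq_eq, Fin.sum_univ_three]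
  ext i j
  fin_cases i <;> fin_cases j <;> simp [pauliVec, pauli, Matrix.mul_apply] <;>
    ring_nf <;> simp [Complex.I_sq]

theorem diracAlpha_sum_add_diracBeta (v : EuclideanSpace ℝ (Fin 3)) (z : ℂ) :
    (v 0 : ℂ) • diracAlpha 0 + (v 1 : ℂ) • diracAlpha 1 + (v 2 : ℂ) • diracAlpha 2 +
      z • diracBeta = fromBlocks (z • 1) (pauliVec v) (pauliVec v) (-(z • 1)) := by
  simp [diracAlpha, diracBeta, pauliVec, fromBlocks_smul, fromBlocks_add]

theorem sq_diracEps (m c : ℝ) (u : EuclideanSpace ℝ (Fin 3)) :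
    diracEps m c u ^ 2 = ‖u‖ ^ 2 + (m * c ^ 2) ^ 2 := by
  rw [diracEps, Real.sq_sqrt (by positivity)]
  ring

theorem diracEps_pos {m c : ℝ} (hm : m ≠ 0) (hc : c ≠ 0) (u : EuclideanSpace ℝ (Fin 3)) :
    0 < diracEps m c u := by
  unfold diracEps
  positivity

/-- `V₊(u)` is an isometry onto the particle eigenspace:
`V₊ᴴV₊ = I₂`, `V₊V₊ᴴ = Π₊(u)` and `H(u,a)V₊ = h₊(u,a)V₊`. -/
theorem diracVplus_isometry (m c : ℝ) (hm : 0 < m) (hc : 0 < c)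
    (u : EuclideanSpace ℝ (Fin 3)) (a : ℝ) :
    (diracVplus m c u)ᴴ * diracVplus m c u = 1 ∧
    diracVplus m c u * (diracVplus m c u)ᴴ = diracProj m c true u ∧
    diracSymbol m c u a * diracVplus m c u
      = ((a + diracEps m c u : ℝ) : ℂ) • diracVplus m c u := by
  have hε := diracEps_pos hm.ne' hc.ne' u
  have hsq := sq_diracEps m c u
  have hS := pauliVec_mul_self u
  have hM : 0 < m * c ^ 2 := by positivity
  have hr : (Real.sqrt (2 * diracEps m c u * (diracEps m c u + m * c ^ 2)))⁻¹ ^ 2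
      * (2 * diracEps m c u * (diracEps m c u + m * c ^ 2)) = 1 := by
    rw [inv_pow, Real.sq_sqrt (by positivity)]
    exact inv_mul_cancel₀ (by positivity)
  rw [show ‖u‖ ^ 2 = diracEps m c u ^ 2 - (m * c ^ 2) ^ 2 by linarith] at hS
  unfold diracVplus diracSymbol diracProj
  rw [diracAlpha_sum_add_diracBeta]
  generalize (Real.sqrt (2 * diracEps m c u * (diracEps m c u + m * c ^ 2)))⁻¹ = k at *
  generalize diracEps m c u = ε at *
  generalize m * c ^ 2 = M at *
  have hk : (k : ℂ) ^ 2 * (2 * ε * (ε + M)) = 1 := by exact_mod_cast hr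
  have hεC : (ε : ℂ) ≠ 0 := by exact_mod_cast hε.ne'
  have hk' : (k : ℂ) ^ 2 * (ε + M) = 1 / 2 * (ε : ℂ)⁻¹ := by
    field_simp
    linear_combination hk
  push_cast at hS ⊢
  rw [conjTranspose_smul, conjTranspose_fromRows_eq_fromCols_conjTranspose, conjTranspose_smul,
    conjTranspose_pauliVec, conjTranspose_one]
  simp only [star_add, RCLike.star_def, conj_ofReal]
  refine ⟨?_, ?_, ?_⟩
  · simp only [Matrix.smul_mul, Matrix.mul_smul, fromCols_mul_fromRows, hS, Matrix.mul_one,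
      smul_smul, ← add_smul]
    convert one_smul ℂ (1 : Matrix (Fin 2) (Fin 2) ℂ) using 2
    linear_combination hk
  · simp only [Matrix.smul_mul, Matrix.mul_smul, fromRows_mul_fromCols, hS, Matrix.mul_one,
      smul_smul, ← fromBlocks_one, fromBlocks_smul, fromBlocks_add, if_true,
      ← smul_neg, zero_add, one_mul, smul_add]
    congr 1
    · rw [← add_smul]
      congr 1
      field_simp
      field_simp at hk'
      linear_combination (ε + M : ℂ) * hk'
    · congr 1
      linear_combination hk'
    · congr 1
      linear_combination hk'
    · rw [smul_neg, ← sub_eq_add_neg, ← sub_smul]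
      congr 1
      field_simp
      field_simp at hk'
      linear_combination (ε - M : ℂ) * hk'
  · rw [Matrix.mul_smul, smul_comm]
    congr 1
    rw [Matrix.add_mul, fromBlocks_mul_fromRows, Matrix.smul_mul, Matrix.one_mul, hS]
    ext i j
    rcases i with i | i <;> simp [Matrix.one_apply]
    · split_ifs <;> ring
    · ring

end
end

section
/- The Zitterbewegung matrix is exactly the particle/anti-particle interference part of the velocity: for every p ∈ ℝ³ and k = 1,2,3, P₀₊(p)·(c·α_k)·P₀₋(p) + P₀₋(p)·(c·α_k)·P₀₊(p) = F_k(p). -/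
open Matrix Complex

noncomputable section

/-- The free Dirac symbol `H₀(p) = c(p₁α₁ + p₂α₂ + p₃α₃) + mc²β`. -/
def freeDirac (m c : ℝ) (p : EuclideanSpace ℝ (Fin 3)) :
    Matrix (Fin 2 ⊕ Fin 2) (Fin 2 ⊕ Fin 2) ℂ :=
  ((c * p 0 : ℝ) : ℂ) • diracAlpha 0 + ((c * p 1 : ℝ) : ℂ) • diracAlpha 1 +
    ((c * p 2 : ℝ) : ℂ) • diracAlpha 2 + ((m * c ^ 2 : ℝ) : ℂ) • diracBeta

/-- `ε₀(p) = √(c²‖p‖² + m²c⁴)`. -/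
def freeEps (m c : ℝ) (p : EuclideanSpace ℝ (Fin 3)) : ℝ :=
  Real.sqrt (c ^ 2 * ‖p‖ ^ 2 + m ^ 2 * c ^ 4)

/-- The spectral projection symbols `P₀± (p) = ½(I₄ ± ε₀(p)⁻¹ H₀(p))`. -/
def freeProj (m c : ℝ) (s : Bool) (p : EuclideanSpace ℝ (Fin 3)) :
    Matrix (Fin 2 ⊕ Fin 2) (Fin 2 ⊕ Fin 2) ℂ :=
  (1 / 2 : ℂ) • ((1 : Matrix (Fin 2 ⊕ Fin 2) (Fin 2 ⊕ Fin 2) ℂ) +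
    (if s then 1 else -1 : ℂ) • (((freeEps m c p)⁻¹ : ℝ) : ℂ) • freeDirac m c p)

/-- The Zitterbewegung matrix `F_k(p) = c·α_k − c²·p_k·H₀(p)⁻¹`. -/
def zitter (m c : ℝ) (k : Fin 3) (p : EuclideanSpace ℝ (Fin 3)) :
    Matrix (Fin 2 ⊕ Fin 2) (Fin 2 ⊕ Fin 2) ℂ :=
  ((c : ℝ) : ℂ) • diracAlpha k - ((c ^ 2 * p k : ℝ) : ℂ) • (freeDirac m c p)⁻¹

lemma freeEps_sq (m c : ℝ) (p : EuclideanSpace ℝ (Fin 3)) :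
    freeEps m c p ^ 2 = (c * p 0) ^ 2 + (c * p 1) ^ 2 + (c * p 2) ^ 2 + (m * c ^ 2) ^ 2 := by
  rw [freeEps, Real.sq_sqrt (by positivity), EuclideanSpace.real_norm_sq_eq, Fin.sum_univ_three]
  ring

lemma freeEps_pos {m c : ℝ} (hm : 0 < m) (hc : 0 < c) (p : EuclideanSpace ℝ (Fin 3)) :
    0 < freeEps m c p :=
  Real.sqrt_pos.mpr (by positivity)

lemma freeDirac_mul_self (m c : ℝ) (p : EuclideanSpace ℝ (Fin 3)) :
    freeDirac m c p * freeDirac m c p = ((freeEps m c p ^ 2 : ℝ) : ℂ) • 1 := by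
  rw [freeEps_sq]
  ext (i | i) (j | j) <;> fin_cases i <;> fin_cases j <;>
    simp [freeDirac, diracAlpha, diracBeta, pauli, Matrix.mul_apply, Fin.sum_univ_two] <;>
    ring_nf <;> simp [Complex.I_sq]

/-- The anticommutator of the free Dirac symbol with `α_k` is the scalar `2 c p_k`. -/
lemma freeDirac_mul_diracAlpha (m c : ℝ) (p : EuclideanSpace ℝ (Fin 3)) (k : Fin 3) :
    freeDirac m c p * diracAlpha k =
      (2 * c * p k : ℂ) • 1 - diracAlpha k * freeDirac m c p := by
  fin_cases k <;> ext (i | i) (j | j) <;> fin_cases i <;> fin_cases j <;>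
    simp [freeDirac, diracAlpha, diracBeta, pauli, Matrix.mul_apply, Fin.sum_univ_two] <;>
    ring_nf <;> simp [Complex.I_sq] <;> ring

lemma freeDirac_inv {m c : ℝ} (hm : 0 < m) (hc : 0 < c) (p : EuclideanSpace ℝ (Fin 3)) :
    (freeDirac m c p)⁻¹ = ((freeEps m c p : ℂ) ^ 2)⁻¹ • freeDirac m c p := by
  have he : (freeEps m c p : ℂ) ≠ 0 := mod_cast (freeEps_pos hm hc p).ne'
  apply Matrix.inv_eq_right_inv
  rw [Matrix.mul_smul, freeDirac_mul_self, smul_smul]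
  push_cast
  rw [inv_mul_cancel₀ (pow_ne_zero 2 he), one_smul]

/-- the Zitterbewegung matrix is exactly the particle/anti-particle
interference part of the velocity matrix `c·α_k`. -/
theorem zitter_eq_interference (m c : ℝ) (hm : 0 < m) (hc : 0 < c)
    (p : EuclideanSpace ℝ (Fin 3)) (k : Fin 3) :
    freeProj m c true p * (((c : ℝ) : ℂ) • diracAlpha k) * freeProj m c false p +
      freeProj m c false p * (((c : ℝ) : ℂ) • diracAlpha k) * freeProj m c true p
      = zitter m c k p := by
  have he : (freeEps m c p : ℂ) ≠ 0 := mod_cast (freeEps_pos hm hc p).ne'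
  have hsandwich : freeDirac m c p * diracAlpha k * freeDirac m c p =
      (2 * c * p k : ℂ) • freeDirac m c p - ((freeEps m c p : ℂ) ^ 2) • diracAlpha k := by
    rw [freeDirac_mul_diracAlpha, Matrix.sub_mul, Matrix.mul_assoc, freeDirac_mul_self]
    simp
  rw [zitter, freeDirac_inv hm hc]
  simp only [freeProj, if_true, Bool.false_eq_true, if_false, Matrix.mul_add, Matrix.add_mul,
    Matrix.mul_smul, Matrix.smul_mul, smul_add, Matrix.one_mul, Matrix.mul_one, hsandwich]
  push_cast
  match_scalars <;> field_simp <;> ring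

end
end

section
/- Reconstruction of a spin observable from its quantiser symbol: for every 2×2 complex matrix M, ∫_{S²} (trace(Δ(n)·M)) · Δ(n) dσ(n) = ½·M, where σ is the uniform probability measure (normalized surface measure) on the unit sphere S² = {n ∈ ℝ³ : ‖n‖ = 1}. In particular the map M ↦ (n ↦ trace(Δ(n)·M)) is injective. -/
open Matrix Complex MeasureTheory Metric

noncomputable section

/-- The spin-1/2 quantiser `Δ(n) = ½(I₂ + √3·(n·σ))`. -/
def quantiser (n : EuclideanSpace ℝ (Fin 3)) : Matrix (Fin 2) (Fin 2) ℂ :=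
  (1 / 2 : ℂ) • ((1 : Matrix (Fin 2) (Fin 2) ℂ) + ((Real.sqrt 3 : ℝ) : ℂ) • pauliVec n)

/-- The uniform probability measure (normalised surface measure) on the unit
sphere `S² ⊂ ℝ³`. -/
def sphereUniform : Measure (sphere (0 : EuclideanSpace ℝ (Fin 3)) 1) :=
  (((volume : Measure (EuclideanSpace ℝ (Fin 3))).toSphere Set.univ)⁻¹ : ENNReal) •
    (volume : Measure (EuclideanSpace ℝ (Fin 3))).toSphere

attribute [local instance] Matrix.normedAddCommGroup Matrix.normedSpace

/-- The self-map of the unit sphere induced by a linear isometry of the ambient space. -/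
def sphereMap {E : Type*} [NormedAddCommGroup E] [NormedSpace ℝ E] (g : E ≃ₗᵢ[ℝ] E)
    (n : sphere (0 : E) 1) : sphere (0 : E) 1 :=
  ⟨g n, by simp⟩

theorem continuous_sphereMap {E : Type*} [NormedAddCommGroup E] [NormedSpace ℝ E]
    (g : E ≃ₗᵢ[ℝ] E) : Continuous (sphereMap g) :=
  (g.continuous.comp continuous_subtype_val).subtype_mk _

open scoped Pointwise in
/-- The surface measure on the unit sphere is invariant under the isometries that preserve the
ambient measure. -/
theorem map_sphereMap_toSphere {E : Type*} [NormedAddCommGroup E] [NormedSpace ℝ E]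
    [MeasurableSpace E] [BorelSpace E] {μ : Measure E} (g : E ≃ₗᵢ[ℝ] E)
    (hg : MeasurePreserving g μ μ) :
    μ.toSphere.map (sphereMap g) = μ.toSphere := by
  have hm := (continuous_sphereMap g).measurable
  ext s hs
  rw [Measure.map_apply hm hs, Measure.toSphere_apply' _ (hm hs), Measure.toSphere_apply' _ hs,
    ← hg.measure_preimage_emb g.toHomeomorph.measurableEmbedding
      (Set.Ioo (0 : ℝ) 1 • (Set.image (↑) s : Set E))]
  congr 2
  ext x
  simp only [Set.mem_preimage, Set.mem_smul, Set.mem_image]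
  constructor
  · rintro ⟨r, hr, _, ⟨n, hn, rfl⟩, rfl⟩
    exact ⟨r, hr, _, ⟨_, hn, rfl⟩, by simp [sphereMap]⟩
  · rintro ⟨r, hr, _, ⟨n, hn, rfl⟩, hx⟩
    refine ⟨r, hr, _, ⟨sphereMap g.symm n, ?_, rfl⟩, g.injective ?_⟩
    · simpa [sphereMap] using hn
    · simpa [sphereMap] using hx

instance : IsProbabilityMeasure sphereUniform where
  measure_univ := by
    rw [sphereUniform, Measure.smul_apply, smul_eq_mul]
    exact ENNReal.inv_mul_cancel
      (Measure.measure_univ_ne_zero.mpr (Measure.toSphere_ne_zero _))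
      (measure_ne_top _ _)

theorem integral_sphereUniform_comp_isometry
    (g : EuclideanSpace ℝ (Fin 3) ≃ₗᵢ[ℝ] EuclideanSpace ℝ (Fin 3))
    {f : EuclideanSpace ℝ (Fin 3) → ℝ} (hf : Continuous f) :
    ∫ n, f (g n.1) ∂sphereUniform = ∫ n, f n.1 ∂sphereUniform := by
  have h : sphereUniform.map (sphereMap g) = sphereUniform := by
    rw [sphereUniform, Measure.map_smul, map_sphereMap_toSphere g g.measurePreserving]
  conv_rhs => rw [← h]
  exact (integral_map (continuous_sphereMap g).aemeasurable
    (hf.comp continuous_subtype_val).aestronglyMeasurable).symm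

/-- The reflection of Euclidean space that changes the sign of the `k`-th coordinate. -/
def coordReflection (k : Fin 3) : EuclideanSpace ℝ (Fin 3) ≃ₗᵢ[ℝ] EuclideanSpace ℝ (Fin 3) :=
  LinearIsometryEquiv.piLpCongrRight 2
    fun i => if i = k then LinearIsometryEquiv.neg ℝ else LinearIsometryEquiv.refl ℝ ℝ

theorem coordReflection_apply (k i : Fin 3) (v : EuclideanSpace ℝ (Fin 3)) :
    coordReflection k v i = if i = k then -v i else v i := by
  simp only [coordReflection, LinearIsometryEquiv.piLpCongrRight_apply]
  split_ifs <;> simp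

theorem integrable_sphereUniform {f : EuclideanSpace ℝ (Fin 3) → ℝ} (hf : Continuous f) :
    Integrable (fun n : sphere (0 : EuclideanSpace ℝ (Fin 3)) 1 => f n) sphereUniform :=
  (hf.comp continuous_subtype_val).integrable_of_hasCompactSupport
    (HasCompactSupport.of_compactSpace _)

theorem integral_sphereUniform_coord (k : Fin 3) :
    ∫ n, n.1 k ∂sphereUniform = 0 := by
  have h := integral_sphereUniform_comp_isometry (coordReflection k)
    (f := fun v => v k) (by fun_prop)
  simp only [coordReflection_apply, if_true, integral_neg] at h
  linarith

theorem integral_sphereUniform_coord_mul_coord_of_ne {k l : Fin 3} (hkl : k ≠ l) :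
    ∫ n, n.1 k * n.1 l ∂sphereUniform = 0 := by
  have h := integral_sphereUniform_comp_isometry (coordReflection k)
    (f := fun v => v k * v l) (by fun_prop)
  simp only [coordReflection_apply, if_true, hkl.symm, if_false, neg_mul, integral_neg] at h
  linarith

theorem integral_sphereUniform_coord_mul_self (k : Fin 3) :
    ∫ n, n.1 k * n.1 k ∂sphereUniform = 1 / 3 := by
  have hswap (l : Fin 3) :
      ∫ n, n.1 l * n.1 l ∂sphereUniform = ∫ n, n.1 k * n.1 k ∂sphereUniform := by
    have h := integral_sphereUniform_comp_isometry
      (LinearIsometryEquiv.piLpCongrLeft 2 ℝ ℝ (Equiv.swap k l))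
      (f := fun v => v k * v k) (by fun_prop)
    simpa [LinearIsometryEquiv.piLpCongrLeft_apply, Equiv.piCongrLeft'] using h
  have hsum : ∑ l, ∫ n, n.1 l * n.1 l ∂sphereUniform = 1 := by
    rw [← integral_finsetSum _ fun l _ =>
      integrable_sphereUniform (f := fun v => v l * v l) (by fun_prop)]
    have hone (n : sphere (0 : EuclideanSpace ℝ (Fin 3)) 1) : ∑ l, n.1 l * n.1 l = 1 := by
      have h := EuclideanSpace.real_norm_sq_eq n.1
      rw [norm_eq_of_mem_sphere] at h
      simpa [sq] using h.symm
    simp [hone]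
  simp only [hswap, Finset.sum_const, Finset.card_univ, Fintype.card_fin, nsmul_eq_mul] at hsum
  push_cast at hsum
  linarith

theorem integral_sphereUniform_coord_mul_coord (k l : Fin 3) :
    ∫ n, n.1 k * n.1 l ∂sphereUniform = if k = l then 1 / 3 else 0 := by
  split_ifs with h
  · rw [h, integral_sphereUniform_coord_mul_self]
  · exact integral_sphereUniform_coord_mul_coord_of_ne h

/-- The completeness relation of the Pauli matrices. -/
theorem trace_smul_one_add_sum_pauli (M : Matrix (Fin 2) (Fin 2) ℂ) :
    M.trace • (1 : Matrix (Fin 2) (Fin 2) ℂ) + ∑ k, (pauli k * M).trace • pauli k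
      = (2 : ℂ) • M := by
  ext i j
  fin_cases i <;> fin_cases j <;>
    simp [Fin.sum_univ_three, pauli, Matrix.trace, Matrix.mul_apply] <;>
    ring_nf <;> simp <;> ring

theorem pauliVec_eq_sum (v : EuclideanSpace ℝ (Fin 3)) : pauliVec v = ∑ k, v k • pauli k := by
  simp [pauliVec, Fin.sum_univ_three]

theorem trace_quantiser_mul_smul_quantiser (M : Matrix (Fin 2) (Fin 2) ℂ)
    (v : EuclideanSpace ℝ (Fin 3)) :
    (quantiser v * M).trace • quantiser v =
      (1 / 4 : ℝ) • (M.trace • (1 : Matrix (Fin 2) (Fin 2) ℂ)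
        + ∑ k, v k • (√3 • (M.trace • pauli k + (pauli k * M).trace • 1))
        + ∑ k, ∑ l, (v k * v l) • ((3 : ℝ) • (pauli k * M).trace • pauli l)) := by
  have h3 : ((√3 : ℝ) : ℂ) * ((√3 : ℝ) : ℂ) = 3 := by
    rw [← Complex.ofReal_mul, Real.mul_self_sqrt (by norm_num)]; norm_num
  have ht : (quantiser v * M).trace
      = (1 / 2 : ℂ) * (M.trace + (√3 : ℝ) * ∑ k, (v k : ℂ) * (pauli k * M).trace) := by
    simp [quantiser, pauliVec, add_mul, Fin.sum_univ_three, Matrix.trace_add]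
    ring
  rw [ht]
  ext i j
  simp only [quantiser, pauliVec, Fin.sum_univ_three, Matrix.smul_apply, Matrix.add_apply,
    smul_eq_mul, Complex.real_smul]
  push_cast
  linear_combination (1 / 4 : ℂ) *
    ((v 0 : ℂ) * (pauli 0 * M).trace + v 1 * (pauli 1 * M).trace + v 2 * (pauli 2 * M).trace) *
    ((v 0 : ℂ) * pauli 0 i j + v 1 * pauli 1 i j + v 2 * pauli 2 i j) * h3

theorem integral_sphereUniform_quadratic {E : Type*} [NormedAddCommGroup E] [NormedSpace ℝ E]
    [CompleteSpace E] (A : E) (B : Fin 3 → E) (C : Fin 3 → Fin 3 → E) :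
    ∫ n, (A + ∑ k, n.1 k • B k + ∑ k, ∑ l, (n.1 k * n.1 l) • C k l) ∂sphereUniform
      = A + (1 / 3 : ℝ) • ∑ k, C k k := by
  have hi1 (k : Fin 3) : Integrable
      (fun n : sphere (0 : EuclideanSpace ℝ (Fin 3)) 1 => n.1 k • B k) sphereUniform :=
    (integrable_sphereUniform (f := fun v => v k) (by fun_prop)).smul_const _
  have hi2 (k l : Fin 3) : Integrable
      (fun n : sphere (0 : EuclideanSpace ℝ (Fin 3)) 1 => (n.1 k * n.1 l) • C k l)
        sphereUniform :=
    (integrable_sphereUniform (f := fun v => v k * v l) (by fun_prop)).smul_const _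
  have hs1 := integrable_finsetSum Finset.univ fun k _ => hi1 k
  have hs2 (k : Fin 3) := integrable_finsetSum Finset.univ fun l _ => hi2 k l
  have hs0 : Integrable (fun n : sphere (0 : EuclideanSpace ℝ (Fin 3)) 1 =>
      A + ∑ k, n.1 k • B k) sphereUniform := (integrable_const A).add hs1
  rw [integral_add hs0 (integrable_finsetSum _ fun k _ => hs2 k),
    integral_add (integrable_const _) hs1, integral_finsetSum _ fun k _ => hi1 k,
    integral_finsetSum _ fun k _ => hs2 k]
  have hC (k : Fin 3) := integral_finsetSum Finset.univ fun l _ => hi2 k l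
  simp [hC, integral_smul_const, integral_sphereUniform_coord,
    integral_sphereUniform_coord_mul_coord, ite_smul, Finset.smul_sum]

theorem integral_trace_quantiser_smul_quantiser (M : Matrix (Fin 2) (Fin 2) ℂ) :
    ∫ n : sphere (0 : EuclideanSpace ℝ (Fin 3)) 1,
      (quantiser n.1 * M).trace • quantiser n.1 ∂sphereUniform = (1 / 2 : ℂ) • M := by
  simp only [trace_quantiser_mul_smul_quantiser]
  rw [integral_smul, integral_sphereUniform_quadratic, ← Finset.smul_sum, smul_smul]
  norm_num only [one_smul]
  rw [trace_smul_one_add_sum_pauli]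
  ext i j
  simp
  ring

/-- reconstruction of a spin observable from its quantiser symbol,
`∫_{S²} tr(Δ(n)M) Δ(n) dσ(n) = ½ M`; in particular `M ↦ tr(Δ(·)M)` is
injective. -/
theorem quantiser_reconstruction :
    (∀ M : Matrix (Fin 2) (Fin 2) ℂ,
      (∫ n : sphere (0 : EuclideanSpace ℝ (Fin 3)) 1,
          ((quantiser (n : EuclideanSpace ℝ (Fin 3)) * M).trace) •
            quantiser (n : EuclideanSpace ℝ (Fin 3)) ∂sphereUniform)
        = (1 / 2 : ℂ) • M) ∧
    Function.Injective (fun M : Matrix (Fin 2) (Fin 2) ℂ =>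
      fun n : sphere (0 : EuclideanSpace ℝ (Fin 3)) 1 =>
        (quantiser (n : EuclideanSpace ℝ (Fin 3)) * M).trace) := by
  refine ⟨integral_trace_quantiser_smul_quantiser, fun M N h => ?_⟩
  have hMN : (1 / 2 : ℂ) • M = (1 / 2 : ℂ) • N := by
    rw [← integral_trace_quantiser_smul_quantiser M, ← integral_trace_quantiser_smul_quantiser N]
    exact integral_congr_ae (.of_forall fun n => congrArg (· • quantiser n.1) (congrFun h n))
  exact smul_right_injective _ (by norm_num : (1 / 2 : ℂ) ≠ 0) hMN

end
end
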